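/- Let C be an (X,s)-neighbour transitive code in H(m,q). Then C is s-regular. Furthermore, if the zero vertex 0 ∈ C and δ ≥ 2s, then for each k with 0 ≤ k ≤ m, the set of codewords of weight k forms a q-ary s-(m,k,λ) design for some nonnegative integer λ. -/

import Mathlib

open Equiv

namespace NT

/-- Vertices of the Hamming graph `H(m,q)`. -/
abbrev V (m q : ℕ) := Fin m → Fin q

/-- The automorphism of `H(m,q)` determined by alphabet permutations `g` and
an entry permutation `σ`:  `α ↦ (i ↦ gᵢ (α (σ⁻¹ i)))`. -/
def hAut (m q : ℕ) (g : Fin m → Perm (Fin q)) (σ : Perm (Fin m)) :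
    Perm (V m q) where
  toFun α := fun i => g i (α (σ⁻¹ i))
  invFun α := fun i => (g (σ i))⁻¹ (α (σ i))
  left_inv α := by funext i; simp
  right_inv α := by funext i; simp

/-- The automorphism group of the Hamming graph, as a subgroup of the group of
all permutations of the vertex set:  `S_q^m ⋊ S_m`. -/
def HammingAut (m q : ℕ) : Subgroup (Perm (V m q)) where
  carrier := {x | ∃ g σ, x = hAut m q g σ}
  one_mem' := ⟨fun _ => 1, 1, by ext α i; simp [hAut]⟩
  mul_mem' := by
    rintro x y ⟨g, σ, rfl⟩ ⟨h, τ, rfl⟩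
    exact ⟨fun i => g i * h (σ⁻¹ i), σ * τ, by ext α i; simp [hAut, Perm.mul_apply]⟩
  inv_mem' := by
    rintro x ⟨g, σ, rfl⟩
    refine ⟨fun i => (g (σ i))⁻¹, σ⁻¹, ?_⟩
    ext α i
    simp [hAut, Perm.inv_def]

/-- The minimum distance of a code `C ⊆ H(m,q)`. -/
noncomputable def minDist (m q : ℕ) (C : Set (V m q)) : ℕ :=
  sInf {d | ∃ α ∈ C, ∃ β ∈ C, α ≠ β ∧ hammingDist α β = d}

/-- The distance `d(α, C)` from a vertex to a code. -/
noncomputable def distTo (m q : ℕ) (C : Set (V m q)) (α : V m q) : ℕ :=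
  sInf {d | ∃ β ∈ C, hammingDist α β = d}

/-- `C_r`, the set of vertices at distance exactly `r` from the code `C`. -/
def cell (m q : ℕ) (C : Set (V m q)) (r : ℕ) : Set (V m q) :=
  {α | distTo m q C α = r}

/-- The covering radius of a code. -/
noncomputable def covRad (m q : ℕ) (C : Set (V m q)) : ℕ :=
  sSup (Set.range (distTo m q C))

/-- `S` is an orbit of the subgroup `X ≤ Sym(V)`. -/
def IsOrbit (m q : ℕ) (X : Subgroup (Perm (V m q))) (S : Set (V m q)) : Prop :=
  S.Nonempty ∧ (∀ x ∈ X, ∀ ν ∈ S, x ν ∈ S) ∧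
    ∀ ν ∈ S, ∀ μ ∈ S, ∃ x ∈ X, x ν = μ

/-- `C` is `(X,s)`-neighbour transitive:  `X` is a group of automorphisms of the
Hamming graph and each of `C, C_1, …, C_s` is an `X`-orbit. -/
def IsNT (m q : ℕ) (X : Subgroup (Perm (V m q))) (C : Set (V m q)) (s : ℕ) : Prop :=
  X ≤ HammingAut m q ∧ IsOrbit m q X C ∧
    ∀ i, 1 ≤ i → i ≤ s → IsOrbit m q X (cell m q C i)

/-- `X` acts faithfully on the set of entries, i.e. `X ∩ S_q^m = 1`. -/
def EntryFaithful (m q : ℕ) (X : Subgroup (Perm (V m q))) : Prop :=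
  ∀ x ∈ X, (∃ g, x = hAut m q g 1) → x = 1

/-- The image of `X` in `S_m` under the entry action `μ`. -/
def entryImage (m q : ℕ) (X : Subgroup (Perm (V m q))) : Set (Perm (Fin m)) :=
  {σ | ∃ x ∈ X, ∃ g, x = hAut m q g σ}

/-- Two codes are equivalent if one is the image of the other under an
automorphism of the Hamming graph. -/
def CodeEquiv (m q : ℕ) (C C' : Set (V m q)) : Prop :=
  ∃ x ∈ HammingAut m q, x '' C = C'

/-- The repetition code: all constant tuples. -/
def RepCode (m q : ℕ) : Set (V m q) := {α | ∃ a, α = fun _ => a}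

/-- The zero vertex. -/
def zeroV (m q : ℕ) [NeZero q] : V m q := fun _ => 0

/-- The weight of a vertex: the number of nonzero entries. -/
noncomputable def wt (m q : ℕ) [NeZero q] (α : V m q) : ℕ :=
  hammingNorm α

/-- `α` covers `ν` if `α` agrees with `ν` on every nonzero entry of `ν`. -/
def Covers (m q : ℕ) [NeZero q] (α ν : V m q) : Prop :=
  ∀ i, ν i ≠ 0 → ν i = α i

/-- A `q`-ary `s-(m,k,λ)` design: a set of weight-`k` vertices such that every
weight-`s` vertex is covered by exactly `λ` of them. -/
noncomputable def IsDesign (m q : ℕ) [NeZero q] (s k lam : ℕ) (D : Set (V m q)) : Prop :=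
  (∀ α ∈ D, wt m q α = k) ∧
    ∀ ν : V m q, wt m q ν = s → {α ∈ D | Covers m q α ν}.ncard = lam

/-- `C` is `s`-regular: for each `i ≤ s` and `k ≤ m`, the number
`|Γ_k(ν) ∩ C|` is the same for all `ν ∈ C_i`. -/
def SRegular (m q : ℕ) (C : Set (V m q)) (s : ℕ) : Prop :=
  ∀ i ≤ s, ∀ k ≤ m, ∀ ν ∈ cell m q C i, ∀ μ ∈ cell m q C i,
    {β ∈ C | hammingDist ν β = k}.ncard = {β ∈ C | hammingDist μ β = k}.ncard

/-- The automorphism group of a code: the setwise stabiliser of `C` in the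
automorphism group of the Hamming graph. -/
def AutCode (m q : ℕ) (C : Set (V m q)) : Subgroup (Perm (V m q)) where
  carrier := {x | x ∈ HammingAut m q ∧ x '' C = C}
  one_mem' := ⟨(HammingAut m q).one_mem, by simp⟩
  mul_mem' := by
    rintro x y ⟨hx, hx'⟩ ⟨hy, hy'⟩
    exact ⟨mul_mem hx hy, by rw [Perm.coe_mul, Set.image_comp, hy', hx']⟩
  inv_mem' := by
    rintro x ⟨hx, hx'⟩
    refine ⟨inv_mem hx, ?_⟩
    conv_lhs => rw [← hx']
    rw [← Set.image_comp]
    simp [Perm.inv_def]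

/-- `N` is a minimal normal subgroup of the (sub)group `H`. -/
def IsMinNormalIn {G : Type*} [Group G] (H N : Subgroup G) : Prop :=
  N ≤ H ∧ N ≠ ⊥ ∧ (∀ h ∈ H, ∀ n ∈ N, h * n * h⁻¹ ∈ N) ∧
    ∀ K : Subgroup G, K ≤ H → K ≠ ⊥ →
      (∀ h ∈ H, ∀ k ∈ K, h * k * h⁻¹ ∈ K) → K ≤ N → K = N

/-- The socle of a subgroup `H`: the subgroup generated by all minimal
normal subgroups of `H`. -/
def socleIn {G : Type*} [Group G] (H : Subgroup G) : Subgroup G :=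
  ⨆ N ∈ {N : Subgroup G | IsMinNormalIn H N}, N

/-- A row of the punctured Hadamard 12 code: the binary vector whose entry at
`a ∈ F₁₁` is `1` exactly when `a - b` is a square in `F₁₁` (including `0`),
corresponding to the translate by `b` of the first row of the normalised Paley
Hadamard matrix of order 12 (with the `*` coordinate deleted, and with the
Hadamard entry `-1` encoded as `1`, `1` as `0`). -/
def hadRow (b : ZMod 11) : V 11 2 :=
  fun i => if ∃ c : ZMod 11, c ^ 2 = ((i : ℕ) : ZMod 11) - b then 1 else 0

/-- The punctured Hadamard code of length 12 in `H(11,2)`: the zero vector and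
all-ones vector (from the all-`(-1)` row of `-H₁₂` and of `H₁₂`), the eleven
weight-6 rows `hadRow b`, and their complements (the rows of `-H₁₂`). -/
def PHad : Set (V 11 2) :=
  {(fun _ => 0), (fun _ => 1)} ∪ Set.range hadRow ∪
    Set.range (fun b => (fun i => 1 - hadRow b i : V 11 2))

/-- The even weight subcode of the punctured Hadamard code of length 12: the
zero vector together with the eleven weight-6 codewords. -/
def ESub : Set (V 11 2) :=
  insert (fun _ => 0) (Set.range hadRow)

end NT

namespace NT

section Isometries

variable {m q : ℕ}

theorem hammingDist_hAut (g : Fin m → Perm (Fin q)) (σ : Perm (Fin m)) (α β : V m q) :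
    hammingDist (hAut m q g σ α) (hAut m q g σ β) = hammingDist α β := by
  unfold hammingDist
  refine Finset.card_bij' (fun i _ => σ⁻¹ i) (fun i _ => σ i) ?_ ?_ ?_ ?_ <;>
    simp [hAut]

theorem hammingDist_of_mem_HammingAut {x : Perm (V m q)} (hx : x ∈ HammingAut m q)
    (α β : V m q) : hammingDist (x α) (x β) = hammingDist α β := by
  obtain ⟨g, σ, rfl⟩ := hx
  exact hammingDist_hAut g σ α β

/-- Vertices of equal weight are related by an automorphism fixing the zero vertex. -/
theorem exists_mem_HammingAut_of_wt_eq [NeZero q] {ν μ : V m q} (h : wt m q ν = wt m q μ) :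
    ∃ x ∈ HammingAut m q, x (zeroV m q) = zeroV m q ∧ x ν = μ := by
  have hcard : Fintype.card {i // ν i ≠ 0} = Fintype.card {i // μ i ≠ 0} := by
    simpa [wt, hammingNorm, Fintype.card_subtype] using h
  let σ := (Fintype.equivOfCardEq hcard).extendSubtype
  have hσ (i) : ν (σ⁻¹ i) = 0 ↔ μ i = 0 := by
    by_cases hi : ν (σ⁻¹ i) = 0
    · have := (Fintype.equivOfCardEq hcard).extendSubtype_not_mem (σ⁻¹ i) (by simpa using hi)
      change ¬ (μ (σ (σ⁻¹ i)) ≠ 0) at this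
      simp_all
    · have := (Fintype.equivOfCardEq hcard).extendSubtype_mem (σ⁻¹ i) hi
      change μ (σ (σ⁻¹ i)) ≠ 0 at this
      simp_all
  refine ⟨_, ⟨fun i => swap (ν (σ⁻¹ i)) (μ i), σ, rfl⟩, ?_, ?_⟩
  · funext i
    change swap (ν (σ⁻¹ i)) (μ i) 0 = 0
    by_cases hi : μ i = 0
    · rw [hi, (hσ i).2 hi, swap_self, refl_apply]
    · exact swap_apply_of_ne_of_ne (fun h0 => hi ((hσ i).1 h0.symm)) (Ne.symm hi)
  · funext i
    exact swap_apply_left _ _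

end Isometries

section Regularity

variable {m q : ℕ} {C : Set (V m q)}

theorem exists_mem_hammingDist_eq_distTo (hC : C.Nonempty) (α : V m q) :
    ∃ β ∈ C, hammingDist α β = distTo m q C α := by
  obtain ⟨β, hβ⟩ := hC
  exact Nat.sInf_mem (s := {d | ∃ β ∈ C, hammingDist α β = d}) ⟨_, β, hβ, rfl⟩

theorem distTo_le {β : V m q} (hβ : β ∈ C) (α : V m q) :
    distTo m q C α ≤ hammingDist α β :=
  Nat.sInf_le ⟨β, hβ, rfl⟩

theorem cell_zero (hC : C.Nonempty) : cell m q C 0 = C := by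
  ext α
  constructor
  · intro hα
    obtain ⟨β, hβ, h⟩ := exists_mem_hammingDist_eq_distTo hC α
    rw [show distTo m q C α = 0 from hα, hammingDist_eq_zero] at h
    rwa [h]
  · intro hα
    simpa [cell] using distTo_le hα α

/-- If `0` is a codeword and `δ ≥ 2s`, every vertex of weight `i ≤ s` lies in `C_i`. -/
theorem mem_cell_wt [NeZero q] {s : ℕ} (h0 : zeroV m q ∈ C) (hδ : 2 * s ≤ minDist m q C)
    {ν : V m q} (hν : wt m q ν ≤ s) : ν ∈ cell m q C (wt m q ν) := by
  have hwt : hammingDist ν (zeroV m q) = wt m q ν := hammingDist_zero_right ν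
  refine le_antisymm (hwt ▸ distTo_le h0 ν) ?_
  obtain ⟨β, hβ, h⟩ := exists_mem_hammingDist_eq_distTo ⟨_, h0⟩ ν
  rw [← h]
  by_cases hb : β = zeroV m q
  · rw [hb, hwt]
  have hmin : minDist m q C ≤ hammingDist β (zeroV m q) := Nat.sInf_le ⟨β, hβ, _, h0, hb, rfl⟩
  have := hammingDist_triangle β ν (zeroV m q)
  rw [hammingDist_comm β ν] at this
  omega

theorem IsNT.ncard_hammingDist_eq {X : Subgroup (Perm (V m q))} {s : ℕ} (hNT : IsNT m q X C s)
    {i : ℕ} (hi : i ≤ s) (k : ℕ) {ν μ : V m q} (hν : ν ∈ cell m q C i)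
    (hμ : μ ∈ cell m q C i) :
    {β ∈ C | hammingDist ν β = k}.ncard = {β ∈ C | hammingDist μ β = k}.ncard := by
  obtain ⟨hX, hC, hcell⟩ := hNT
  have horb : IsOrbit m q X (cell m q C i) := by
    rcases Nat.eq_zero_or_pos i with rfl | hpos
    · rwa [cell_zero hC.1]
    · exact hcell i hpos hi
  obtain ⟨x, hx, rfl⟩ := horb.2.2 ν hν μ hμ
  refine Set.ncard_congr (fun β _ => x β) ?_ (fun _ _ _ _ h => x.injective h) ?_
  · rintro β ⟨hβ, rfl⟩
    exact ⟨hC.2.1 x hx β hβ, hammingDist_of_mem_HammingAut (hX hx) _ _⟩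
  · rintro β ⟨hβ, rfl⟩
    refine ⟨x⁻¹ β, ⟨hC.2.1 _ (inv_mem hx) β hβ, ?_⟩, by simp⟩
    simpa using (hammingDist_of_mem_HammingAut (hX hx) ν (x⁻¹ β)).symm

end Regularity

section Weights

variable {m q : ℕ} [NeZero q]

theorem hammingDist_add_card_filter (ν β : V m q) :
    hammingDist ν β + {i | ν i ≠ 0 ∧ β i ≠ 0}.ncard =
      wt m q β + {i | ν i ≠ 0 ∧ ν i ≠ β i}.ncard := by
  simp only [Set.ncard_eq_toFinset_card', Set.toFinset_ofPred, hammingDist, wt, hammingNorm,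
    Finset.card_filter, ← Finset.sum_add_distrib]
  refine Finset.sum_congr rfl fun i _ => ?_
  by_cases h1 : ν i = 0 <;> by_cases h2 : β i = 0 <;> by_cases h3 : ν i = β i <;> simp_all

theorem wt_le_hammingDist_add_wt (ν β : V m q) :
    wt m q β ≤ hammingDist ν β + wt m q ν := by
  have := hammingDist_triangle β ν (zeroV m q)
  rw [hammingDist_comm β ν] at this
  exact this.trans_eq' (hammingDist_zero_right β).symm |>.trans_eq
    (congrArg _ (hammingDist_zero_right ν))

/-- A vertex is covered by `β` exactly when it lies on a geodesic from `0` to `β`. -/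
theorem covers_iff (ν β : V m q) :
    Covers m q β ν ↔ hammingDist ν β + wt m q ν = wt m q β := by
  have key : hammingDist ν β + wt m q ν =
      wt m q β + ∑ i, ((if ν i ≠ 0 ∧ ν i ≠ β i then 1 else 0) +
        (if ν i ≠ 0 ∧ β i = 0 then 1 else 0)) := by
    simp only [hammingDist, wt, hammingNorm, Finset.card_filter, ← Finset.sum_add_distrib]
    refine Finset.sum_congr rfl fun i _ => ?_
    by_cases h1 : ν i = 0 <;> by_cases h2 : β i = 0 <;> by_cases h3 : ν i = β i <;> simp_all
  rw [key, Nat.add_eq_left, Finset.sum_eq_zero_iff]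
  refine forall_congr' fun i => ?_
  by_cases h1 : ν i = 0 <;> by_cases h2 : β i = 0 <;> by_cases h3 : ν i = β i <;> simp_all

end Weights

section Functionals

open scoped Classical in
/-- The sum of `φ` over the vertices satisfying `P`. -/
noncomputable def sumOn {m q : ℕ} (φ : V m q → ℤ) (P : V m q → Prop) : ℤ :=
  ∑ β with P β, φ β

variable {m q : ℕ} {φ : V m q → ℤ}

theorem sumOn_congr {P Q : V m q → Prop} (h : ∀ β, P β ↔ Q β) : sumOn φ P = sumOn φ Q := by
  rw [show P = Q from funext fun β => propext (h β)]

theorem sumOn_fiberwise {ι : Type*} [DecidableEq ι] (P : V m q → Prop) (T : Finset ι)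
    (f : V m q → ι) (hf : ∀ β, P β → f β ∈ T) :
    sumOn φ P = ∑ t ∈ T, sumOn φ fun β => P β ∧ f β = t := by
  classical
  unfold sumOn
  rw [← Finset.sum_fiberwise_of_maps_to (g := f) (t := T) (fun β hβ => hf β (by simpa using hβ))]
  exact Finset.sum_congr rfl fun t _ => by simp only [Finset.filter_filter]

variable [NeZero q] {s : ℕ} {P : V m q → Prop}

/-- If the sums over the vertices covering a given vertex vanish up to weight `s`, so do the sums
over the vertices with prescribed values on at most `s` entries. -/
theorem sumOn_agree_eq_zero
    (h : ∀ μ : V m q, wt m q μ ≤ s → sumOn φ (fun β => P β ∧ Covers m q β μ) = 0)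
    (S : Finset (Fin m)) (hS : S.card ≤ s) (p : V m q) :
    sumOn φ (fun β => P β ∧ ∀ i ∈ S, β i = p i) = 0 := by
  classical
  induction hn : (S.filter fun i => p i = 0).card using Nat.strong_induction_on
    generalizing S p with
  | _ n ih =>
  by_cases hz : ∃ i ∈ S, p i = 0
  · obtain ⟨i, hi, hpi⟩ := hz
    have hlt : ((S.erase i).filter fun j => p j = 0).card < n := by
      rw [← hn]
      exact Finset.card_lt_card (Finset.ssubset_iff.2 ⟨i, by simp, by
        intro j hj; simp at hj ⊢; rcases hj with rfl | hj <;> simp_all⟩)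
    have hfree := ih _ hlt (S.erase i) ((Finset.card_erase_le).trans hS) p rfl
    rw [sumOn_fiberwise _ Finset.univ (fun β => β i) (by simp),
      ← Finset.add_sum_erase _ _ (Finset.mem_univ (0 : Fin q)), Finset.sum_eq_zero, add_zero]
      at hfree
    · rw [← hfree]
      refine sumOn_congr fun β => ?_
      rw [and_assoc]
      refine and_congr_right fun _ => ⟨fun hβ => ⟨fun j hj => hβ j (Finset.mem_of_mem_erase hj),
        (hβ i hi).trans hpi⟩, fun hβ j hj => ?_⟩
      by_cases hji : j = i
      · rw [hji, hβ.2, hpi]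
      · exact hβ.1 j (Finset.mem_erase.2 ⟨hji, hj⟩)
    · intro c hc
      have hc0 : c ≠ 0 := Finset.ne_of_mem_erase hc
      have hlt' : (S.filter fun j => Function.update p i c j = 0).card < n := by
        refine lt_of_le_of_lt (Finset.card_le_card fun j hj => ?_) hlt
        by_cases hji : j = i
        · subst hji; simp_all
        · simp_all
      rw [← ih _ hlt' S hS _ rfl]
      refine sumOn_congr fun β => ?_
      rw [and_assoc]
      refine and_congr_right fun _ => ⟨fun hβ j hj => ?_, fun hβ => ⟨fun j hj => ?_, ?_⟩⟩
      · by_cases hji : j = i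
        · subst hji; simpa using hβ.2
        · simpa [hji] using hβ.1 j (Finset.mem_erase.2 ⟨hji, hj⟩)
      · simpa [Finset.ne_of_mem_erase hj] using hβ j (Finset.mem_of_mem_erase hj)
      · simpa using hβ i hi
  · push Not at hz
    have hw : wt m q (fun i => if i ∈ S then p i else 0) ≤ s := by
      unfold wt hammingNorm
      refine le_trans (Finset.card_le_card fun i hi => ?_) hS
      by_contra hiS
      simp [hiS] at hi
    rw [← h _ hw]
    refine sumOn_congr fun β => and_congr_right fun _ => forall_congr' fun i => ?_
    by_cases hi : i ∈ S
    · simp [hi, hz i hi, eq_comm]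
    · simp [hi]

/-- Under the hypothesis of `sumOn_agree_eq_zero`, sums over conditions that depend on at most `s`
entries vanish. -/
theorem sumOn_local_eq_zero
    (h : ∀ μ : V m q, wt m q μ ≤ s → sumOn φ (fun β => P β ∧ Covers m q β μ) = 0)
    (S : Finset (Fin m)) (hS : S.card ≤ s) (Q : V m q → Prop)
    (hQ : ∀ β γ : V m q, (∀ i ∈ S, β i = γ i) → (Q β ↔ Q γ)) :
    sumOn φ (fun β => P β ∧ Q β) = 0 := by
  classical
  let π : V m q → V m q := fun β i => if i ∈ S then β i else 0
  have hπ (β γ) : π β = π γ ↔ ∀ i ∈ S, β i = γ i := by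
    refine ⟨fun e i hi => by simpa [π, hi] using congrFun e i, fun e => funext fun i => ?_⟩
    by_cases hi : i ∈ S
    · simp [π, hi, e i hi]
    · simp [π, hi]
  rw [sumOn_fiberwise _ (Finset.univ.filter Q |>.image π) π fun β hβ =>
    Finset.mem_image_of_mem _ (by simpa using hβ.2)]
  refine Finset.sum_eq_zero fun t ht => ?_
  obtain ⟨γ, hγ, rfl⟩ := Finset.mem_image.1 ht
  rw [← sumOn_agree_eq_zero h S hS γ]
  refine sumOn_congr fun β => ?_
  rw [and_assoc, hπ]
  exact and_congr_right fun _ =>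
    ⟨fun e => e.2, fun e => ⟨(hQ β γ e).2 (by simpa using hγ), e⟩⟩

/-- If the sums of `φ` over all spheres centred at vertices of weight at most `s` vanish, then so
do the sums over the weight-`k` vertices covering a vertex of weight at most `s`. -/
theorem sumOn_covers_eq_zero
    (h : ∀ ν : V m q, wt m q ν ≤ s → ∀ k, sumOn φ (fun β => hammingDist ν β = k) = 0)
    (k : ℕ) (ν : V m q) (hν : wt m q ν ≤ s) :
    sumOn φ (fun β => wt m q β = k ∧ Covers m q β ν) = 0 := by
  classical
  induction k using Nat.strong_induction_on generalizing ν with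
  | _ k ih =>
  by_cases hk : wt m q ν ≤ k
  · have hsum := h ν hν (k - wt m q ν)
    rw [sumOn_fiberwise _ (Finset.range (k + 1)) (wt m q) (fun β hβ => by
        have := wt_le_hammingDist_add_wt ν β
        rw [Finset.mem_range]
        omega), Finset.sum_range_succ, Finset.sum_eq_zero, zero_add] at hsum
    · rw [← hsum]
      refine sumOn_congr fun β => ?_
      rw [covers_iff]
      omega
    · intro w hw
      rw [← sumOn_local_eq_zero (fun μ hμ => ih w (Finset.mem_range.1 hw) μ hμ)
        (Finset.univ.filter fun i => ν i ≠ 0) hν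
        (fun β => k - wt m q ν + {i | ν i ≠ 0 ∧ β i ≠ 0}.ncard =
          w + {i | ν i ≠ 0 ∧ ν i ≠ β i}.ncard) ?_]
      · refine sumOn_congr fun β => ?_
        have := hammingDist_add_card_filter ν β
        omega
      · intro β γ e
        have e' (i) (hi : ν i ≠ 0) : β i = γ i := e i (by simpa using hi)
        have e1 : {i | ν i ≠ 0 ∧ β i ≠ 0} = {i | ν i ≠ 0 ∧ γ i ≠ 0} := by
          ext i
          exact and_congr_right fun hi => by rw [e' i hi]
        have e2 : {i | ν i ≠ 0 ∧ ν i ≠ β i} = {i | ν i ≠ 0 ∧ ν i ≠ γ i} := by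
          ext i
          exact and_congr_right fun hi => by rw [e' i hi]
        rw [e1, e2]
  · rw [sumOn_congr (Q := fun _ => False), sumOn, Finset.sum_filter]
    · simp
    · intro β
      simp only [covers_iff, iff_false]
      omega

end Functionals

section Designs

variable {m q : ℕ}

theorem sumOn_indicator_sub (C : Set (V m q)) (x : Perm (V m q)) (P P' : V m q → Prop)
    (hP : ∀ β, P β ↔ P' (x β)) :
    sumOn (fun β => C.indicator 1 β - C.indicator 1 (x β)) P =
      ({β ∈ C | P β}.ncard : ℤ) - {β ∈ C | P' β}.ncard := by
  classical
  have hcount (R : V m q → Prop) :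
      ∑ β with R β, C.indicator (1 : V m q → ℤ) β = ({β ∈ C | R β}.ncard : ℤ) := by
    simp [Set.ncard_eq_toFinset_card', Set.indicator_apply, Finset.sum_boole,
      Finset.filter_filter, and_comm]
  rw [sumOn, Finset.sum_sub_distrib, hcount, ← hcount P']
  congr 1
  exact Finset.sum_equiv x (by simp [hP]) (by simp)

/-- If the number of codewords at each distance from a vertex of weight at most `s` depends only on
the weight, then so does the number of weight-`k` codewords covering it. -/
theorem ncard_covers_eq [NeZero q] {C : Set (V m q)} {s : ℕ}
    (h : ∀ ν μ : V m q, wt m q ν ≤ s → wt m q ν = wt m q μ → ∀ k,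
      {β ∈ C | hammingDist ν β = k}.ncard = {β ∈ C | hammingDist μ β = k}.ncard)
    (k : ℕ) {ν μ : V m q} (hν : wt m q ν ≤ s) (hνμ : wt m q ν = wt m q μ) :
    {β ∈ {β ∈ C | wt m q β = k} | Covers m q β ν}.ncard =
      {β ∈ {β ∈ C | wt m q β = k} | Covers m q β μ}.ncard := by
  obtain ⟨x, hx, hx0, rfl⟩ := exists_mem_HammingAut_of_wt_eq hνμ
  have hwt (β) : wt m q (x β) = wt m q β := by
    have := hammingDist_of_mem_HammingAut hx β (zeroV m q)
    rw [hx0] at this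
    exact (hammingDist_zero_right (x β)).symm.trans (this.trans (hammingDist_zero_right β))
  have hdist := hammingDist_of_mem_HammingAut hx
  have hzero := sumOn_covers_eq_zero (s := s)
    (φ := fun β => C.indicator 1 β - C.indicator 1 (x β))
    (fun τ hτ j => by
      rw [sumOn_indicator_sub C x _ (fun β => hammingDist (x τ) β = j) (fun β => by rw [hdist]),
        h τ (x τ) hτ (hwt τ).symm j, sub_self]) k ν hν
  rw [sumOn_indicator_sub C x _ (fun β => wt m q β = k ∧ Covers m q β (x ν))
    (fun β => by rw [covers_iff, covers_iff, hdist, hwt, hwt]), sub_eq_zero] at hzero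
  simpa only [Set.mem_ofPred_eq, and_assoc] using Nat.cast_injective hzero

end Designs

end NT

open NT Equiv in
/-- Lemma 2.16: an `(X,s)`-neighbour transitive code is `s`-regular;
moreover if `0 ∈ C` and `δ ≥ 2s` then for each `k ≤ m` the codewords of weight `k`
form a `q`-ary `s-(m,k,λ)` design for some `λ ≥ 0`. -/
theorem stmt_11 (m q : ℕ) [NeZero q] (hm : 2 ≤ m) (hq : 2 ≤ q)
    (X : Subgroup (Perm (V m q))) (C : Set (V m q)) (s : ℕ)
    (hNT : IsNT m q X C s) :
    SRegular m q C s ∧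
    (zeroV m q ∈ C → 2 * s ≤ minDist m q C →
      ∀ k ≤ m, ∃ lam : ℕ, IsDesign m q s k lam {β ∈ C | wt m q β = k}) := by
  refine ⟨fun i hi k _ ν hν μ hμ => hNT.ncard_hammingDist_eq hi k hν hμ, fun h0 hδ k _ => ?_⟩
  have key {ν μ : V m q} := ncard_covers_eq (ν := ν) (μ := μ) (C := C) (s := s) (fun ν μ hν hνμ k =>
    hNT.ncard_hammingDist_eq hν k (mem_cell_wt h0 hδ hν)
      (hνμ ▸ mem_cell_wt h0 hδ (hνμ ▸ hν))) k
  by_cases hex : ∃ ν : V m q, wt m q ν = s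
  · obtain ⟨ν, hν⟩ := hex
    exact ⟨_, fun α hα => hα.2, fun μ hμ => key hμ.le (hμ.trans hν.symm)⟩
  · exact ⟨0, fun α hα => hα.2, fun μ hμ => (hex ⟨μ, hμ⟩).elim⟩
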